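/- arXiv:1306.4006 — 2 statements merged into one kernel-verified Lean document; each statement's English description precedes it below -/
import Mathlib

section
/- Let F be a field and let a, b, c, d be nonzero elements of F, and set D = abcd. Let M be the derived subalgebra of the Lie algebra of 4×4 matrices over F that are skew-adjoint with respect to the diagonal matrix J = diag(a,b,c,d) (i.e. matrices x with xᵀJ = -Jx), and let M₃ be the derived subalgebra of the Lie algebra of 3×3 matrices over F skew-adjoint with respect to diag(a,b,c). Then M is isomorphic, as a Lie algebra over F, to the current Lie algebra M₃ ⊗_F F[X]/(X² - D). -/
open scoped TensorProduct
open Polynomial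

section
variable {F n : Type*} [Field F] [Fintype n] [DecidableEq n]

attribute [local instance] LieRing.ofAssociativeRing

theorem mem_skewAdjoint_diagonal {v : n → F} {x : Matrix n n F} :
    x ∈ skewAdjointMatricesLieSubalgebra (Matrix.diagonal v) ↔
      ∀ i j, v i * x i j = -(v j * x j i) := by
  rw [mem_skewAdjointMatricesLieSubalgebra, mem_skewAdjointMatricesSubmodule,
    Matrix.IsSkewAdjoint, Matrix.IsAdjointPair, ← Matrix.ext_iff]
  simp only [Matrix.mul_diagonal, Matrix.diagonal_mul, Matrix.transpose_apply, Matrix.neg_apply]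
  constructor
  · intro h i j
    linear_combination h j i
  · intro h i j
    linear_combination h j i

theorem lie_apply_self_of_skewAdjoint_diagonal {v : n → F} (hv : ∀ i, v i ≠ 0)
    (x y : skewAdjointMatricesLieSubalgebra (Matrix.diagonal v)) (i : n) :
    (⁅x, y⁆ : skewAdjointMatricesLieSubalgebra (Matrix.diagonal v)).1 i i = 0 := by
  rw [LieSubalgebra.coe_bracket, LieRing.of_associative_ring_bracket, Matrix.sub_apply,
    Matrix.mul_apply, Matrix.mul_apply, ← Finset.sum_sub_distrib]
  refine Finset.sum_eq_zero fun j _ => ?_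
  have hx := mem_skewAdjoint_diagonal.1 x.2 i j
  have hy := mem_skewAdjoint_diagonal.1 y.2 i j
  refine mul_left_cancel₀ (hv i) (mul_left_cancel₀ (hv j) ?_)
  linear_combination v j * y.1 j i * hx - v j * x.1 j i * hy

/-- The matrix `J⁻¹ (E i j - E j i)`, skew-adjoint for `J = diagonal v`. -/
def skewSingle (v : n → F) (hv : ∀ i, v i ≠ 0) (i j : n) :
    skewAdjointMatricesLieSubalgebra (Matrix.diagonal v) :=
  ⟨Matrix.single i j (v i)⁻¹ - Matrix.single j i (v j)⁻¹, by
    rw [mem_skewAdjoint_diagonal]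
    intro k l
    have := hv i
    have := hv j
    simp only [Matrix.sub_apply, Matrix.single_apply]
    by_cases h₁ : i = k <;> by_cases h₂ : j = l <;> by_cases h₃ : i = l <;> by_cases h₄ : j = k <;>
      simp_all⟩

theorem lie_skewSingle {v : n → F} (hv : ∀ i, v i ≠ 0) {i j k : n} (hij : i ≠ j)
    (hki : k ≠ i) (hkj : k ≠ j) :
    v k • ⁅skewSingle v hv i k, skewSingle v hv k j⁆ = skewSingle v hv i j := by
  have := hv k
  apply Subtype.ext
  rw [SetLike.val_smul, LieSubalgebra.coe_bracket, LieRing.of_associative_ring_bracket]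
  simp only [skewSingle, mul_sub, sub_mul]
  simp [hij, hij.symm, hki, hki.symm, hkj, hkj.symm, smul_sub, mul_left_comm (v k), this]

theorem eq_sum_skewSingle [LinearOrder n] {v : n → F} (hv : ∀ i, v i ≠ 0)
    (x : skewAdjointMatricesLieSubalgebra (Matrix.diagonal v)) (hx : ∀ i, x.1 i i = 0) :
    x = ∑ i, ∑ j, if i < j then (v i * x.1 i j) • skewSingle v hv i j else 0 := by
  apply Subtype.ext
  ext k l
  have hs : ∀ i j, (if i < j then (v i * x.1 i j) • skewSingle v hv i j else 0).1 k l =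
      (if k = i then if l = j then if i < j then x.1 i j else 0 else 0 else 0) +
      (if l = i then if k = j then if i < j then x.1 j i else 0 else 0 else 0) := by
    intro i j
    have hi := hv i
    have hj := hv j
    have h := mem_skewAdjoint_diagonal.1 x.2 i j
    simp only [apply_ite Subtype.val, apply_ite (fun y : Matrix n n F => y k l), skewSingle,
      SetLike.val_smul, Matrix.smul_apply, Matrix.sub_apply, Matrix.single_apply, smul_eq_mul,
      ZeroMemClass.coe_zero, Matrix.zero_apply, mul_sub, mul_ite, mul_zero]
    have hi' : v i * x.1 i j * (v i)⁻¹ = x.1 i j := by field_simp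
    have hj' : v i * x.1 i j * (v j)⁻¹ = -x.1 j i := by rw [h]; field_simp
    rw [hi', hj']
    grind
  simp only [AddSubmonoidClass.coe_finsetSum, Matrix.sum_apply, hs, Finset.sum_add_distrib]
  rcases lt_trichotomy k l with h | rfl | h
  · simp [h, h.not_gt]
  · simp [hx]
  · simp [h, h.not_gt]

theorem mem_derivedSeries_skewAdjoint_diagonal [LinearOrder n] {v : n → F} (hv : ∀ i, v i ≠ 0)
    (hn : ∀ i j : n, ∃ k, k ≠ i ∧ k ≠ j)
    {x : skewAdjointMatricesLieSubalgebra (Matrix.diagonal v)} :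
    x ∈ LieAlgebra.derivedSeries F (skewAdjointMatricesLieSubalgebra (Matrix.diagonal v)) 1 ↔
      ∀ i, x.1 i i = 0 := by
  rw [LieAlgebra.derivedSeries_def, LieAlgebra.derivedSeriesOfIdeal_succ,
    LieAlgebra.derivedSeriesOfIdeal_zero]
  constructor
  · rw [← LieSubmodule.mem_toSubmodule, LieSubmodule.lieIdeal_oper_eq_linear_span']
    intro h
    induction h using Submodule.span_induction with
    | mem x h =>
      obtain ⟨y, -, z, -, rfl⟩ := h
      exact lie_apply_self_of_skewAdjoint_diagonal hv y z
    | zero => simp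
    | add x y _ _ h₁ h₂ => simp [h₁, h₂]
    | smul r x _ h => simp [h]
  · intro h
    rw [eq_sum_skewSingle hv x h]
    refine sum_mem fun i _ => sum_mem fun j _ => ?_
    split_ifs with hij
    · obtain ⟨k, hki, hkj⟩ := hn i j
      rw [← lie_skewSingle hv hij.ne hki hkj]
      exact SMulMemClass.smul_mem _ (SMulMemClass.smul_mem _
        (LieSubmodule.lie_mem_lie (LieSubmodule.mem_top _) (LieSubmodule.mem_top _)))
    · exact zero_mem _
end

theorem nonempty_lieEquiv_restrictScalars_tensor {F A L L' : Type*} [Field F] [CommRing A]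
    [Algebra F A] [LieRing L] [LieAlgebra F L] [LieRing L'] [LieAlgebra F L'] {D : F}
    (b : Module.Basis (Fin 2) F A) (hb₀ : b 0 = 1) (hb₁ : b 1 * b 1 = algebraMap F A D)
    (g : (L × L) ≃ₗ[F] L')
    (hg : ∀ x y : L × L, ⁅g x, g y⁆ =
      g (⁅x.1, y.1⁆ + D • ⁅x.2, y.2⁆, ⁅x.1, y.2⁆ + ⁅x.2, y.1⁆)) :
    Nonempty (L' ≃ₗ⁅F⁆ RestrictScalars F A (A ⊗[F] L)) := by
  let s : (L × L) ≃ₗ[F] A ⊗[F] L := (LinearEquiv.finTwoArrow F L).symm ≪≫ₗ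
    (Finsupp.linearEquivFunOnFinite F L (Fin 2)).symm ≪≫ₗ
    (TensorProduct.equivFinsuppOfBasisLeft b).symm
  have hs : ∀ x, s x = 1 ⊗ₜ x.1 + b 1 ⊗ₜ x.2 := by
    intro x
    simp [s, Finsupp.sum_fintype, hb₀]
  have hsl : ∀ x y, s (⁅x.1, y.1⁆ + D • ⁅x.2, y.2⁆, ⁅x.1, y.2⁆ + ⁅x.2, y.1⁆) = ⁅s x, s y⁆ := by
    intro x y
    simp only [hs, lie_add, add_lie, LieAlgebra.ExtendScalars.bracket_tmul, hb₁, mul_one, one_mul,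
      TensorProduct.tmul_add, Algebra.algebraMap_eq_smul_one, TensorProduct.smul_tmul]
    abel
  let e := g.symm ≪≫ₗ s
  refine ⟨⟨⟨⟨⟨e, e.map_add⟩, fun r x => ?_⟩, fun {x y} => ?_⟩, e.symm, e.left_inv, e.right_inv⟩⟩
  · refine (e.map_smul r x).trans (algebraMap_smul A r (e x)).symm
  · obtain ⟨x, rfl⟩ := g.surjective x
    obtain ⟨y, rfl⟩ := g.surjective y
    change s (g.symm _) = ⁅s (g.symm _), s (g.symm _)⁆
    rw [hg]
    simp [hsl]

theorem exists_basis_adjoinRoot_X_sq_sub_C {F : Type*} [Field F] (D : F) :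
    ∃ b : Module.Basis (Fin 2) F (AdjoinRoot ((X : F[X]) ^ 2 - C D)),
      b 0 = 1 ∧ b 1 * b 1 = algebraMap F _ D := by
  have hm : ((X : F[X]) ^ 2 - C D).Monic := monic_X_pow_sub_C D two_ne_zero
  have hn : (AdjoinRoot.powerBasis' hm).dim = 2 := natDegree_X_pow_sub_C
  refine ⟨(AdjoinRoot.powerBasis' hm).basis.reindex (finCongr hn), ?_, ?_⟩
  · simp
  · have : AdjoinRoot.root ((X : F[X]) ^ 2 - C D) ^ 2 = AdjoinRoot.of _ D := by
      have := AdjoinRoot.eval₂_root ((X : F[X]) ^ 2 - C D)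
      simpa [sub_eq_zero] using this
    simpa [← pow_two] using this

/-- The star. -/
def blockStar {F : Type*} [Field F] (a b c d : F) (m n : Matrix (Fin 3) (Fin 3) F) :
    Matrix (Fin 4) (Fin 4) F :=
  !![m 0 0, m 0 1, m 0 2, b * d * n 1 2;
     m 1 0, m 1 1, m 1 2, c * d * n 2 0;
     m 2 0, m 2 1, m 2 2, a * d * n 0 1;
     -(a * b * n 1 2), -(b * c * n 2 0), -(a * c * n 0 1), 0]

/-- The star. -/
def coblockStar {F : Type*} [Field F] (a b c d : F) (x : Matrix (Fin 4) (Fin 4) F) :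
    Matrix (Fin 3) (Fin 3) F :=
  !![0, x 2 3 / (a * d), -x 1 3 / (a * d);
     -x 2 3 / (b * d), 0, x 0 3 / (b * d);
     x 1 3 / (c * d), -x 0 3 / (c * d), 0]

section
variable {F : Type*} [Field F] {a b c d : F}

theorem mem_derivedSeries_skewAdjoint_diagonal_three (ha : a ≠ 0) (hb : b ≠ 0) (hc : c ≠ 0)
    {x : skewAdjointMatricesLieSubalgebra (Matrix.diagonal ![a, b, c])} :
    x ∈ LieAlgebra.derivedSeries F
      (skewAdjointMatricesLieSubalgebra (Matrix.diagonal ![a, b, c])) 1 ↔ ∀ i, x.1 i i = 0 :=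
  mem_derivedSeries_skewAdjoint_diagonal (by simp [Fin.forall_fin_succ, *]) (by decide)

theorem mem_derivedSeries_skewAdjoint_diagonal_four (ha : a ≠ 0) (hb : b ≠ 0) (hc : c ≠ 0)
    (hd : d ≠ 0) {x : skewAdjointMatricesLieSubalgebra (Matrix.diagonal ![a, b, c, d])} :
    x ∈ LieAlgebra.derivedSeries F
      (skewAdjointMatricesLieSubalgebra (Matrix.diagonal ![a, b, c, d])) 1 ↔ ∀ i, x.1 i i = 0 :=
  mem_derivedSeries_skewAdjoint_diagonal (by simp [Fin.forall_fin_succ, *]) (by decide)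

/-- Coordinates on the derived algebra of the skew-adjoint matrices for `diag(a, b, c)`. -/
def skewAdjointCoordThree (ha : a ≠ 0) (hb : b ≠ 0) (hc : c ≠ 0) : (Fin 3 → F) ≃ₗ[F]
    LieAlgebra.derivedSeries F
      (skewAdjointMatricesLieSubalgebra (Matrix.diagonal ![a, b, c])) 1 where
  toFun p := ⟨⟨!![0, p 2 / a, -p 1 / a; -p 2 / b, 0, p 0 / b; p 1 / c, -p 0 / c, 0], by
      rw [mem_skewAdjoint_diagonal]
      simp [Fin.forall_fin_succ, mul_div_cancel₀, ha, hb, hc]⟩, by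
    rw [mem_derivedSeries_skewAdjoint_diagonal_three ha hb hc]
    simp [Fin.forall_fin_succ]⟩
  map_add' p q := by
    refine Subtype.ext (Subtype.ext ?_)
    ext i j
    fin_cases i <;> fin_cases j <;> simp <;> ring
  map_smul' r p := by
    refine Subtype.ext (Subtype.ext ?_)
    ext i j
    fin_cases i <;> fin_cases j <;> simp <;> ring
  invFun x := ![b * x.1.1 1 2, c * x.1.1 2 0, a * x.1.1 0 1]
  left_inv p := by
    ext i
    fin_cases i <;> simp [mul_div_cancel₀, ha, hb, hc]
  right_inv x := by
    have h₀ := (mem_derivedSeries_skewAdjoint_diagonal_three ha hb hc).1 x.2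
    have h := mem_skewAdjoint_diagonal.1 x.1.2
    refine Subtype.ext (Subtype.ext ?_)
    have h01 := h 0 1
    have h02 := h 0 2
    have h12 := h 1 2
    simp at h01 h02 h12
    ext i j
    fin_cases i <;> fin_cases j <;> simp [h₀] <;> field_simp <;> simp [*]

set_option maxHeartbeats 1000000 in
/-- Coordinates on the derived algebra of the skew-adjoint matrices for `diag(a, b, c, d)`. -/
def skewAdjointCoordFour (ha : a ≠ 0) (hb : b ≠ 0) (hc : c ≠ 0) (hd : d ≠ 0) :
    ((Fin 3 → F) × (Fin 3 → F)) ≃ₗ[F]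
    LieAlgebra.derivedSeries F
      (skewAdjointMatricesLieSubalgebra (Matrix.diagonal ![a, b, c, d])) 1 where
  toFun p := ⟨⟨!![0, p.1 2 / a, -p.1 1 / a, d * p.2 0;
      -p.1 2 / b, 0, p.1 0 / b, d * p.2 1;
      p.1 1 / c, -p.1 0 / c, 0, d * p.2 2;
      -(a * p.2 0), -(b * p.2 1), -(c * p.2 2), 0], by
      rw [mem_skewAdjoint_diagonal]
      simp [Fin.forall_fin_succ, mul_div_cancel₀, ha, hb, hc, mul_left_comm d]⟩, by
    rw [mem_derivedSeries_skewAdjoint_diagonal_four ha hb hc hd]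
    simp [Fin.forall_fin_succ]⟩
  map_add' p q := by
    refine Subtype.ext (Subtype.ext ?_)
    ext i j
    fin_cases i <;> fin_cases j <;> simp <;> ring
  map_smul' r p := by
    refine Subtype.ext (Subtype.ext ?_)
    ext i j
    fin_cases i <;> fin_cases j <;> simp <;> ring
  invFun x := (![b * x.1.1 1 2, c * x.1.1 2 0, a * x.1.1 0 1],
    ![x.1.1 0 3 / d, x.1.1 1 3 / d, x.1.1 2 3 / d])
  left_inv p := by
    ext i <;> fin_cases i <;> simp [mul_div_cancel₀, ha, hb, hc, hd]
  right_inv x := by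
    have h₀ := (mem_derivedSeries_skewAdjoint_diagonal_four ha hb hc hd).1 x.2
    have h := mem_skewAdjoint_diagonal.1 x.1.2
    refine Subtype.ext (Subtype.ext ?_)
    have h01 := h 0 1
    have h02 := h 0 2
    have h12 := h 1 2
    have h03 := h 0 3
    have h13 := h 1 3
    have h23 := h 2 3
    simp at h01 h02 h12 h03 h13 h23
    ext i j
    fin_cases i <;> fin_cases j <;> simp [h₀] <;> field_simp <;> simp [*]

/-- The bracket of the derived algebra for `diag(a, b, c)` in the coordinates of
`skewAdjointCoordThree`: the cross product twisted by the diagonal. -/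
def skewCross (a b c : F) (p q : Fin 3 → F) : Fin 3 → F :=
  ![(p 2 * q 1 - p 1 * q 2) / a, (p 0 * q 2 - p 2 * q 0) / b, (p 1 * q 0 - p 0 * q 1) / c]

attribute [local instance] LieRing.ofAssociativeRing

theorem coe_lie_derivedSeries_skewAdjoint {n : Type*} [Fintype n] [DecidableEq n]
    {J : Matrix n n F} {k : ℕ}
    (x y : LieAlgebra.derivedSeries F (skewAdjointMatricesLieSubalgebra J) k) :
    ⁅x, y⁆.1.1 = x.1.1 * y.1.1 - y.1.1 * x.1.1 :=
  rfl

theorem lie_skewAdjointCoordThree (ha : a ≠ 0) (hb : b ≠ 0) (hc : c ≠ 0) (p q : Fin 3 → F) :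
    ⁅skewAdjointCoordThree ha hb hc p, skewAdjointCoordThree ha hb hc q⁆ =
      skewAdjointCoordThree ha hb hc (skewCross a b c p q) := by
  refine Subtype.ext (Subtype.ext ?_)
  rw [coe_lie_derivedSeries_skewAdjoint]
  ext i j
  fin_cases i <;> fin_cases j <;>
    simp [skewAdjointCoordThree, skewCross] <;>
    field_simp <;> ring

set_option maxHeartbeats 1000000 in
theorem lie_skewAdjointCoordFour (ha : a ≠ 0) (hb : b ≠ 0) (hc : c ≠ 0) (hd : d ≠ 0)
    (p q : (Fin 3 → F) × (Fin 3 → F)) :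
    ⁅skewAdjointCoordFour ha hb hc hd p, skewAdjointCoordFour ha hb hc hd q⁆ =
      skewAdjointCoordFour ha hb hc hd
        (skewCross a b c p.1 q.1 + (a * b * c * d) • skewCross a b c p.2 q.2,
          skewCross a b c p.1 q.2 + skewCross a b c p.2 q.1) := by
  refine Subtype.ext (Subtype.ext ?_)
  rw [coe_lie_derivedSeries_skewAdjoint]
  ext i j
  fin_cases i <;> fin_cases j <;>
    simp [skewAdjointCoordFour, skewCross] <;>
    field_simp <;> ring

end

theorem stmt0 (F : Type*) [Field F] (a b c d : F) (ha : a ≠ 0) (hb : b ≠ 0)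
    (hc : c ≠ 0) (hd : d ≠ 0) (D : F) (hD : D = a * b * c * d) :
    letI J : Matrix (Fin 4) (Fin 4) F := Matrix.diagonal ![a, b, c, d]
    letI J₃ : Matrix (Fin 3) (Fin 3) F := Matrix.diagonal ![a, b, c]
    letI M := LieAlgebra.derivedSeries F (skewAdjointMatricesLieSubalgebra J) 1
    letI M₃ := LieAlgebra.derivedSeries F (skewAdjointMatricesLieSubalgebra J₃) 1
    letI A := F[X] ⧸ Ideal.span {(X : F[X]) ^ 2 - C D}
    Nonempty (M ≃ₗ⁅F⁆ RestrictScalars F A (A ⊗[F] M₃)) := by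
  obtain ⟨e, he₀, he₁⟩ := exists_basis_adjoinRoot_X_sq_sub_C D
  let E := skewAdjointCoordThree ha hb hc
  refine nonempty_lieEquiv_restrictScalars_tensor (A := AdjoinRoot ((X : F[X]) ^ 2 - C D))
    e he₀ he₁ ((E.symm.prodCongr E.symm) ≪≫ₗ skewAdjointCoordFour ha hb hc hd) fun x y => ?_
  obtain ⟨x, rfl⟩ := (E.prodCongr E).surjective x
  obtain ⟨y, rfl⟩ := (E.prodCongr E).surjective y
  simp only [E, LinearEquiv.trans_apply, LinearEquiv.prodCongr_apply, LinearEquiv.symm_apply_apply,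
    lie_skewAdjointCoordThree, lie_skewAdjointCoordFour, hD, map_add, map_smul]
end

section
/- Let F be a field, V a 4-dimensional F-vector space, and f a non-degenerate symmetric bilinear form on V; if char F = 2 assume further that f is not alternating. Let L(f) be the Lie algebra of endomorphisms of V skew-adjoint with respect to f, and let M = [L(f), L(f)]. Then M has dimension 6 over F. -/
section

attribute [local instance] LieRing.ofAssociativeRing

variable {F V : Type*} [Field F] [AddCommGroup V] [Module F V]

/-- The endomorphism `x ↦ f u x • v - f v x • u` attached to a bilinear form `f`. -/
def LinearMap.BilinForm.rotation (f : LinearMap.BilinForm F V) (u v : V) : Module.End F V :=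
  (f u).smulRight v - (f v).smulRight u

namespace LinearMap.BilinForm

variable {f : LinearMap.BilinForm F V}

@[simp]
theorem rotation_apply (u v x : V) : f.rotation u v x = f u x • v - f v x • u := rfl

theorem mem_skewAdjointLieSubalgebra_iff {x : Module.End F V} :
    x ∈ skewAdjointLieSubalgebra f ↔ ∀ u v, f (x u) v = -f u (x v) := by
  change x ∈ f.skewAdjointSubmodule ↔ _
  simp [mem_skewAdjointSubmodule, LinearMap.IsSkewAdjoint, LinearMap.IsAdjointPair]

theorem rotation_mem_skewAdjointLieSubalgebra (hf : f.IsSymm) (u v : V) :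
    f.rotation u v ∈ skewAdjointLieSubalgebra f := by
  rw [mem_skewAdjointLieSubalgebra_iff]
  intro x y
  simp only [rotation_apply, map_sub, map_smul, LinearMap.sub_apply, LinearMap.smul_apply,
    smul_eq_mul, hf.eq x v, hf.eq x u]
  ring

variable (f) in
/-- The derived subalgebra of the skew-adjoint endomorphisms, as a space of endomorphisms. -/
def derivedSkewAdjoint : Submodule F (Module.End F V) :=
  (LieAlgebra.derivedSeries F (skewAdjointLieSubalgebra f) 1).toSubmodule.map
    (skewAdjointLieSubalgebra f).toSubmodule.subtype

theorem finrank_derivedSkewAdjoint :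
    Module.finrank F f.derivedSkewAdjoint =
      Module.finrank F (LieAlgebra.derivedSeries F (skewAdjointLieSubalgebra f) 1) :=
  (Submodule.equivMapOfInjective _ (Submodule.subtype_injective _) _).finrank_eq.symm

theorem mul_sub_mul_mem_derivedSkewAdjoint {x y : Module.End F V}
    (hx : x ∈ skewAdjointLieSubalgebra f) (hy : y ∈ skewAdjointLieSubalgebra f) :
    x * y - y * x ∈ f.derivedSkewAdjoint := by
  refine ⟨⁅(⟨x, hx⟩ : skewAdjointLieSubalgebra f), ⟨y, hy⟩⁆, ?_, rfl⟩
  exact LieSubmodule.lie_mem_lie (LieSubmodule.mem_top _) (LieSubmodule.mem_top _)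

theorem apply_self_of_mem_derivedSkewAdjoint (hf : f.IsSymm) {x : Module.End F V}
    (hx : x ∈ f.derivedSkewAdjoint) (u : V) : f (x u) u = 0 := by
  obtain ⟨x, hx, rfl⟩ := hx
  have hx' : x ∈ (⁅(⊤ : LieIdeal F (skewAdjointLieSubalgebra f)),
      (⊤ : LieIdeal F (skewAdjointLieSubalgebra f))⁆).toSubmodule := hx
  rw [LieSubmodule.lieIdeal_oper_eq_linear_span'] at hx'
  clear hx
  induction hx' using Submodule.span_induction with
  | mem x h =>
    obtain ⟨a, -, b, -, rfl⟩ := h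
    change f (a.1 (b.1 u) - b.1 (a.1 u)) u = 0
    rw [map_sub, LinearMap.sub_apply, mem_skewAdjointLieSubalgebra_iff.1 a.2,
      mem_skewAdjointLieSubalgebra_iff.1 b.2, neg_neg, hf.eq u, sub_self]
  | zero => simp
  | add x y _ _ hx hy => simpa using congrArg₂ (· + ·) hx hy
  | smul c x _ hx => simpa using Or.inr hx

theorem rotation_lie_of_apply_eq_zero (hf : f.IsSymm) {u v w z : V} (hwv : f w v = 0)
    (hzv : f z v = 0) (hzu : f z u = 0) (hwu : f w u = 1) :
    f.rotation w z * f.rotation u v - f.rotation u v * f.rotation w z = f.rotation z v := by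
  ext x
  simp only [LinearMap.sub_apply, Module.End.mul_apply, rotation_apply, map_sub, map_smul,
    hwv, hzv, hzu, hwu, hf.eq u z, hf.eq v z, hf.eq u w, hf.eq v w]
  module

theorem rotation_add_left (u u' v : V) :
    f.rotation (u + u') v = f.rotation u v + f.rotation u' v := by
  ext x
  simp only [rotation_apply, LinearMap.add_apply, map_add]
  module

theorem rotation_sub_left (u u' v : V) :
    f.rotation (u - u') v = f.rotation u v - f.rotation u' v := by
  ext x
  simp only [rotation_apply, LinearMap.sub_apply, map_sub]
  module

theorem rotation_smul_left (c : F) (u v : V) :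
    f.rotation (c • u) v = c • f.rotation u v := by
  ext x
  simp only [rotation_apply, LinearMap.smul_apply, map_smul, smul_eq_mul]
  module

theorem rotation_self (v : V) : f.rotation v v = 0 := sub_self _

theorem rotation_swap (u v : V) : f.rotation u v = -f.rotation v u := (neg_sub _ _).symm

theorem exists_apply_eq_zero_notMem_span_singleton [FiniteDimensional F V]
    (hV : 2 < Module.finrank F V) (g : Module.Dual F V) (v : V) :
    ∃ u, g u = 0 ∧ u ∉ Submodule.span F {v} := by
  by_contra! h
  have hle : LinearMap.ker g ≤ Submodule.span F {v} := fun u hu => h u hu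
  have h₁ := Submodule.finrank_mono hle
  have h₂ : Module.finrank F (Submodule.span F {v}) ≤ 1 := by
    simpa using finrank_span_le_card (R := F) ({v} : Set V)
  have h₃ := LinearMap.finrank_range_add_finrank_ker g
  have h₄ := Submodule.finrank_le (LinearMap.range g)
  rw [Module.finrank_self] at h₄
  omega

theorem exists_apply_eq_zero_apply_eq_one (hnd : f.Nondegenerate) {u v : V}
    (huv : u ∉ Submodule.span F {v}) : ∃ w, f v w = 0 ∧ f u w = 1 := by
  obtain ⟨w, hv, hu⟩ : ∃ w, f v w = 0 ∧ f u w ≠ 0 := by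
    by_contra! h
    apply huv
    have hmem := mem_span_of_iInf_ker_le_ker (L := fun _ : Unit => f v) (K := f u)
      (fun w hw => h w (by simpa using hw))
    rw [Set.range_const, Submodule.mem_span_singleton] at hmem
    obtain ⟨c, hc⟩ := hmem
    refine Submodule.mem_span_singleton.2 ⟨c, sub_eq_zero.1 (hnd.1 _ fun w => ?_)⟩
    rw [map_sub, map_smul, hc, sub_self, LinearMap.zero_apply]
  exact ⟨(f u w)⁻¹ • w, by simp [hv], by simp [hu]⟩

theorem rotation_mem_of_apply_eq_zero [FiniteDimensional F V] (hV : 2 < Module.finrank F V)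
    (hf : f.IsSymm) (hnd : f.Nondegenerate) {z v : V} (hzv : f z v = 0) :
    f.rotation z v ∈ f.derivedSkewAdjoint := by
  obtain ⟨u, hzu, huv⟩ := exists_apply_eq_zero_notMem_span_singleton hV (f z) v
  obtain ⟨w, hvw, huw⟩ := exists_apply_eq_zero_apply_eq_one hnd huv
  rw [hf.eq] at hvw huw
  rw [← rotation_lie_of_apply_eq_zero hf hvw hzv hzu huw]
  exact mul_sub_mul_mem_derivedSkewAdjoint (rotation_mem_skewAdjointLieSubalgebra hf _ _)
    (rotation_mem_skewAdjointLieSubalgebra hf _ _)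

theorem rotation_mem_of_apply_self_ne_zero [FiniteDimensional F V]
    (hV : 2 < Module.finrank F V) (hf : f.IsSymm) (hnd : f.Nondegenerate) {v : V}
    (hv : f v v ≠ 0) (z : V) : f.rotation z v ∈ f.derivedSkewAdjoint := by
  have h : f.rotation (z - (f z v / f v v) • v) v ∈ f.derivedSkewAdjoint :=
    rotation_mem_of_apply_eq_zero hV hf hnd (by simp [hv])
  rwa [rotation_sub_left, rotation_smul_left, rotation_self, smul_zero, sub_zero] at h

theorem rotation_mem_derivedSkewAdjoint [FiniteDimensional F V]
    (hV : 2 < Module.finrank F V) (hf : f.IsSymm) (hnd : f.Nondegenerate) (halt : ¬ f.IsAlt)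
    (z v : V) : f.rotation z v ∈ f.derivedSkewAdjoint := by
  have key {u : V} (hu : f u u ≠ 0) : f.rotation u v ∈ f.derivedSkewAdjoint := by
    rw [rotation_swap]
    exact neg_mem (rotation_mem_of_apply_self_ne_zero hV hf hnd hu v)
  obtain ⟨w, hw⟩ : ∃ w, f w w ≠ 0 := by
    by_contra! h
    exact halt h
  by_cases hz : f z z = 0
  · by_cases h₁ : f (z + w) (z + w) = 0
    · by_cases h₂ : f (z - w) (z - w) = 0
      · simp only [map_add, map_sub, LinearMap.add_apply, LinearMap.sub_apply, hz,
          hf.eq w z] at h₁ h₂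
        have htwo : (2 : F) = 0 := by
          apply (mul_eq_zero.1 (_ : (2 : F) * f w w = 0)).resolve_right hw
          linear_combination h₁ + h₂
        exact absurd (by linear_combination h₁ - f z w * htwo) hw
      · simpa [rotation_sub_left] using add_mem (key h₂) (key hw)
    · simpa [rotation_add_left] using sub_mem (key h₁) (key hw)
  · exact key hz

theorem not_isAlt_of_ringChar_ne_two [Nontrivial V] (hf : f.IsSymm) (hnd : f.Nondegenerate)
    (hF : ringChar F ≠ 2) : ¬ f.IsAlt := by
  intro halt
  obtain ⟨v, hv⟩ := exists_ne (0 : V)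
  refine hv (hnd.1 v fun w => ?_)
  have h := halt.neg_eq v w
  rw [hf.eq w v] at h
  exact (Ring.eq_self_iff_eq_zero_of_char_ne_two hF).1 h

theorem apply_swap_of_mem_derivedSkewAdjoint (hf : f.IsSymm) {x : Module.End F V}
    (hx : x ∈ f.derivedSkewAdjoint) (u v : V) : f (x u) v = -f (x v) u := by
  have h := apply_self_of_mem_derivedSkewAdjoint hf hx
  have huv := h (u + v)
  simp only [map_add, LinearMap.add_apply, h u, h v] at huv
  linear_combination huv

theorem finrank_derivedSkewAdjoint_eq_card [FiniteDimensional F V] {ι : Type*} [Fintype ι]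
    [LinearOrder ι] (b : Module.Basis ι F V) (hV : 2 < Module.finrank F V) (hf : f.IsSymm)
    (hnd : f.Nondegenerate) (halt : ¬ f.IsAlt) :
    Module.finrank F f.derivedSkewAdjoint = Fintype.card {p : ι × ι // p.1 < p.2} := by
  let entries : f.derivedSkewAdjoint →ₗ[F] {p : ι × ι // p.1 < p.2} → F :=
    { toFun := fun x p => f (x.1 (b p.1.1)) (b p.1.2)
      map_add' := fun x y => by ext p; simp
      map_smul' := fun c x => by ext p; simp }
  have hinj : Function.Injective entries := by
    refine (injective_iff_map_eq_zero _).2 fun x hx => Subtype.ext (b.ext fun i => ?_)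
    have hlt {i j : ι} (hij : i < j) : f (x.1 (b i)) (b j) = 0 := congrFun hx ⟨(i, j), hij⟩
    have hzero : f (x.1 (b i)) = 0 := by
      refine b.ext fun j => ?_
      rcases lt_trichotomy i j with hij | rfl | hij
      · exact hlt hij
      · exact apply_self_of_mem_derivedSkewAdjoint hf x.2 _
      · rw [apply_swap_of_mem_derivedSkewAdjoint hf x.2, hlt hij, neg_zero,
          LinearMap.zero_apply]
    exact hnd.1 _ fun w => by rw [hzero, LinearMap.zero_apply]
  have hsurj : Function.Surjective entries := by
    rw [← LinearMap.range_eq_top, eq_top_iff, ← (Pi.basisFun F _).span_eq, Submodule.span_le]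
    rintro _ ⟨⟨⟨k, l⟩, hkl⟩, rfl⟩
    refine ⟨⟨f.rotation (f.dualBasis hnd b k) (f.dualBasis hnd b l),
      rotation_mem_derivedSkewAdjoint hV hf hnd halt _ _⟩, ?_⟩
    ext ⟨⟨i, j⟩, hij⟩
    change f (f.rotation _ _ (b i)) (b j) = _
    simp only [rotation_apply, map_sub, map_smul, LinearMap.sub_apply, LinearMap.smul_apply,
      apply_dualBasis_left, smul_eq_mul, Pi.basisFun_apply, Pi.single_apply, Subtype.mk.injEq,
      Prod.mk.injEq]
    dsimp only at hij hkl
    grind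
  rw [(LinearEquiv.ofBijective entries ⟨hinj, hsurj⟩).finrank_eq, Module.finrank_pi]

end LinearMap.BilinForm
end
theorem stmt8 (F : Type*) [Field F] (V : Type*) [AddCommGroup V] [Module F V]
    [FiniteDimensional F V] (hV : Module.finrank F V = 4)
    (f : LinearMap.BilinForm F V) (hsymm : f.IsSymm) (hnd : f.Nondegenerate)
    (halt : ringChar F = 2 → ¬ f.IsAlt) :
    Module.finrank F
      (LieAlgebra.derivedSeries F (skewAdjointLieSubalgebra f) 1) = 6 := by
  have : Nontrivial V := Module.nontrivial_of_finrank_pos (R := F) (by omega)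
  have hna : ¬ f.IsAlt := by
    by_cases hF : ringChar F = 2
    · exact halt hF
    · exact LinearMap.BilinForm.not_isAlt_of_ringChar_ne_two hsymm hnd hF
  rw [← LinearMap.BilinForm.finrank_derivedSkewAdjoint,
    LinearMap.BilinForm.finrank_derivedSkewAdjoint_eq_card (Module.finBasisOfFinrankEq F V hV)
      (by omega) hsymm hnd hna]
  decide
end
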